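/- Let (Λ,d) be a finitely aligned k-graph. A family {t_λ : λ ∈ Λ} of partial isometries satisfying relations (CK1)–(CK3) is a Cuntz–Krieger Λ-family (i.e. also satisfies (CK4)) if and only if ∏_{λ ∈ E} (t_v − t_λ t_λ*) = 0 for every vertex v and every finite exhaustive subset E ⊆ ⋃_{i=1}^{k} vΛ^{e_i} consisting of edges. -/

import Mathlib

open scoped BigOperators

/-- A `k`-graph: a countable small category (in arrows-only presentation, with objects
identified with the identity morphisms) together with a degree functor into `ℕ^k`
satisfying the factorisation property.  `comp l m` is the composite path `lm`
(first `m`, then `l` in categorical order; range `rng l`, source `src m`), and is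
only meaningful when `src l = rng m`. -/
structure KGraph (k : ℕ) where
  Path : Type
  countable : Countable Path
  src : Path → Path
  rng : Path → Path
  comp : Path → Path → Path
  deg : Path → Fin k → ℕ
  deg_src : ∀ l, deg (src l) = 0
  deg_rng : ∀ l, deg (rng l) = 0
  src_eq_of_deg_zero : ∀ v, deg v = 0 → src v = v
  rng_eq_of_deg_zero : ∀ v, deg v = 0 → rng v = v
  comp_src_self : ∀ l, comp l (src l) = l
  rng_comp_self : ∀ l, comp (rng l) l = l
  src_comp : ∀ l m, src l = rng m → src (comp l m) = src m
  rng_comp : ∀ l m, src l = rng m → rng (comp l m) = rng l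
  deg_comp : ∀ l m, src l = rng m → deg (comp l m) = deg l + deg m
  comp_assoc : ∀ l m n, src l = rng m → src m = rng n →
    comp (comp l m) n = comp l (comp m n)
  factorisation : ∀ (l : Path) (m n : Fin k → ℕ), deg l = m + n →
    ∃! p : Path × Path, deg p.1 = m ∧ deg p.2 = n ∧ src p.1 = rng p.2 ∧
      comp p.1 p.2 = l

namespace KGraph

variable {k : ℕ} (Λ : KGraph k)

/-- The vertices of a `k`-graph are the paths of degree `0`. -/
def IsVertex (v : Λ.Path) : Prop := Λ.deg v = 0

/-- An edge is a path of degree `e_i` for some `i`. -/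
def IsEdge (e : Λ.Path) : Prop := ∃ i : Fin k, Λ.deg e = Pi.single i 1

/-- `vΛ`, the set of paths with range `v`. -/
def withRange (v : Λ.Path) : Set Λ.Path := {l | Λ.rng l = v}

/-- `Λ^min(l,m)`, the set of pairs giving minimal common extensions of `l` and `m`. -/
def minExt (l m : Λ.Path) : Set (Λ.Path × Λ.Path) :=
  {p | Λ.src l = Λ.rng p.1 ∧ Λ.src m = Λ.rng p.2 ∧
    Λ.comp l p.1 = Λ.comp m p.2 ∧ Λ.deg (Λ.comp l p.1) = Λ.deg l ⊔ Λ.deg m}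

/-- A `k`-graph is finitely aligned if all the sets `Λ^min(l,m)` are finite. -/
def FinitelyAligned : Prop := ∀ l m, (Λ.minExt l m).Finite

/-- A subset `E ⊆ vΛ` is exhaustive if every path in `vΛ` has a common extension
with some member of `E`. -/
def Exhaustive (v : Λ.Path) (E : Set Λ.Path) : Prop :=
  ∀ m ∈ Λ.withRange v, ∃ l ∈ E, (Λ.minExt l m).Nonempty

/-- `Λ^{≤ n}`. -/
def degLe (n : Fin k → ℕ) : Set Λ.Path :=
  {l | Λ.deg l ≤ n ∧ ∀ i : Fin k, Λ.deg l i < n i →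
    ¬∃ e, Λ.rng e = Λ.src l ∧ Λ.deg e = Pi.single i 1}

end KGraph

open Classical in
/-- The sum of `f` over a set `S`, defined to be `0` if `S` is infinite. -/
noncomputable def setSum {ι A : Type*} [AddCommMonoid A] (S : Set ι) (f : ι → A) : A :=
  if h : S.Finite then ∑ i ∈ h.toFinset, f i else 0

open Classical in
/-- The product of `f` over a set `S` taken in an arbitrary (but fixed) order,
defined to be `1` if `S` is infinite.  All products appearing below have commuting
factors, for which this is the usual product over a finite set. -/
noncomputable def setProd {ι A : Type*} [Monoid A] (S : Set ι) (f : ι → A) : A :=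
  if h : S.Finite then (h.toFinset.toList.map f).prod else 1

namespace KGraph

variable {k : ℕ} (Λ : KGraph k) {A : Type*} [Ring A] [StarRing A]

/-- Relations (CK1)–(CK3) for a family of partial isometries indexed by a `k`-graph. -/
structure IsCK13 (t : Λ.Path → A) : Prop where
  partialIsometry : ∀ l, t l * star (t l) * t l = t l
  vertex_projection : ∀ v, Λ.IsVertex v → star (t v) = t v ∧ t v * t v = t v
  vertex_orthogonal : ∀ v w, Λ.IsVertex v → Λ.IsVertex w → v ≠ w → t v * t w = 0
  comp_mul : ∀ l m, Λ.src l = Λ.rng m → t l * t m = t (Λ.comp l m)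
  ck3 : ∀ l m, star (t l) * t m =
    setSum (Λ.minExt l m) fun p => t p.1 * star (t p.2)

/-- A Cuntz–Krieger `Λ`-family: relations (CK1)–(CK4). -/
structure IsCKFamily (t : Λ.Path → A) extends IsCK13 Λ t : Prop where
  ck4 : ∀ v E, Λ.IsVertex v → E ⊆ Λ.withRange v → E.Finite → Λ.Exhaustive v E →
    setProd E (fun l => t v - t l * star (t l)) = 0

/-- Condition (†) on a subset `F ⊆ Λ`. -/
def DaggerClosed (F : Set Λ.Path) : Prop :=
  ∀ l m σ τ a b, l ∈ F → m ∈ F → σ ∈ F → τ ∈ F →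
    Λ.deg l = Λ.deg m → Λ.deg σ = Λ.deg τ →
    Λ.src l = Λ.src m → Λ.src σ = Λ.src τ →
    (a, b) ∈ Λ.minExt m σ → Λ.comp l a ∈ F ∧ Λ.comp τ b ∈ F

/-- `ΠE`, the smallest subset of `Λ` containing `E` and satisfying (†). -/
def piSet (E : Set Λ.Path) : Set Λ.Path := ⋂₀ {F | E ⊆ F ∧ Λ.DaggerClosed F}

/-- For `P ⊆ Λ` and a path `l`, the set `{ν ∈ s(l)Λ : d(ν) > 0 and lν ∈ P}`;
with `P = ΠE` this is the set `T(l)`. -/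
def extInto (P : Set Λ.Path) (l : Λ.Path) : Set Λ.Path :=
  {ν | Λ.src l = Λ.rng ν ∧ Λ.deg ν ≠ 0 ∧ Λ.comp l ν ∈ P}

/-- The projection `Q(t)^{ΠE}_l`. -/
noncomputable def Qproj (t : Λ.Path → A) (E : Set Λ.Path) (l : Λ.Path) : A :=
  t l * star (t l) *
    setProd (Λ.extInto (Λ.piSet E) l)
      (fun ν => t l * star (t l) - t (Λ.comp l ν) * star (t (Λ.comp l ν)))

/-- The matrix unit `Θ(t,E;l,m) = Q(t)^{ΠE}_l t_l t_m^*`. -/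
noncomputable def Theta (t : Λ.Path → A) (E : Set Λ.Path) (l m : Λ.Path) : A :=
  Λ.Qproj t E l * (t l * star (t m))

end KGraph

/-- A degree-preserving functor `x : Ω_{k,m} → Λ` for some `m ∈ (ℕ ∪ {∞})^k`,
recorded by its degree `m` and its values `map p q` on the morphisms `(p,q)` of
`Ω_{k,m}` (normalised to the junk value `map 0 0` on pairs `(p,q)` that are not
morphisms of `Ω_{k,m}`). -/
structure OmegaMor {k : ℕ} (Λ : KGraph k) where
  m : Fin k → ℕ∞
  map : (Fin k → ℕ) → (Fin k → ℕ) → Λ.Path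
  deg_map : ∀ p q : Fin k → ℕ, p ≤ q → (∀ i, (q i : ℕ∞) ≤ m i) →
    Λ.deg (map p q) = q - p
  rng_map : ∀ p q : Fin k → ℕ, p ≤ q → (∀ i, (q i : ℕ∞) ≤ m i) →
    Λ.rng (map p q) = map p p
  src_map : ∀ p q : Fin k → ℕ, p ≤ q → (∀ i, (q i : ℕ∞) ≤ m i) →
    Λ.src (map p q) = map q q
  comp_map : ∀ p q r : Fin k → ℕ, p ≤ q → q ≤ r → (∀ i, (r i : ℕ∞) ≤ m i) →
    Λ.comp (map p q) (map q r) = map p r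
  map_default : ∀ p q : Fin k → ℕ, ¬(p ≤ q ∧ ∀ i, (q i : ℕ∞) ≤ m i) →
    map p q = map 0 0

/-- `x` is a boundary path: there is `n_x ≤ m` such that whenever `n_x ≤ n ≤ m`
and `n_i = m_i`, the vertex `x(n)` receives no edge of degree `e_i`. -/
def OmegaMor.IsBoundary {k : ℕ} {Λ : KGraph k} (x : OmegaMor Λ) : Prop :=
  ∃ nx : Fin k → ℕ, (∀ i, (nx i : ℕ∞) ≤ x.m i) ∧
    ∀ n : Fin k → ℕ, nx ≤ n → (∀ i, (n i : ℕ∞) ≤ x.m i) →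
      ∀ i : Fin k, (n i : ℕ∞) = x.m i →
        ¬∃ e, Λ.rng e = x.map n n ∧ Λ.deg e = Pi.single i 1


section Products

variable {ι A : Type*}

theorem List.exists_prod_map_eq_mul_of_mem [Monoid A] (f : ι → A)
    (hf : ∀ a b, Commute (f a) (f b)) (L : List ι) {a : ι} (ha : a ∈ L) :
    ∃ c, (L.map f).prod = c * f a := by
  induction L with
  | nil => simp at ha
  | cons b L ih =>
    rw [List.map_cons, List.prod_cons]
    rcases List.mem_cons.mp ha with rfl | h
    · refine ⟨(L.map f).prod, (Commute.list_prod_right _ _ ?_).eq⟩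
      intro y hy
      obtain ⟨z, -, rfl⟩ := List.mem_map.mp hy
      exact hf _ _
    · obtain ⟨c, hc⟩ := ih h
      exact ⟨f b * c, by rw [hc, mul_assoc]⟩

theorem exists_setProd_eq_mul_of_mem [Monoid A] {S : Set ι} (hS : S.Finite) (f : ι → A)
    (hf : ∀ a b, Commute (f a) (f b)) {a : ι} (ha : a ∈ S) :
    ∃ c, setProd S f = c * f a := by
  rw [setProd, dif_pos hS]
  exact List.exists_prod_map_eq_mul_of_mem f hf _ (by simpa using ha)

theorem List.mul_prod_map_eq_self [Monoid A] (f : ι → A) (x : A) (L : List ι)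
    (h : ∀ a ∈ L, x * f a = x) : x * (L.map f).prod = x := by
  induction L with
  | nil => simp
  | cons b L ih =>
    rw [List.map_cons, List.prod_cons, ← mul_assoc, h b (by simp)]
    exact ih fun a ha => h a (by simp [ha])

theorem mul_setProd_eq_self [Monoid A] {S : Set ι} (f : ι → A) (x : A)
    (h : ∀ a ∈ S, x * f a = x) : x * setProd S f = x := by
  rw [setProd]
  split_ifs with hS
  · exact List.mul_prod_map_eq_self f x _ fun a ha => h a (by simpa using ha)
  · exact mul_one x

end Products

namespace KGraph

variable {k : ℕ} (Λ : KGraph k)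

theorem eq_rng_of_deg_eq_zero {l : Λ.Path} (h : Λ.deg l = 0) : l = Λ.rng l :=
  (Λ.rng_eq_of_deg_zero l h).symm

theorem rng_src (l : Λ.Path) : Λ.rng (Λ.src l) = Λ.src l :=
  Λ.rng_eq_of_deg_zero _ (Λ.deg_src l)

theorem src_rng (l : Λ.Path) : Λ.src (Λ.rng l) = Λ.rng l :=
  Λ.src_eq_of_deg_zero _ (Λ.deg_rng l)

theorem comp_inj {l l' a a' : Λ.Path} (h : Λ.src l = Λ.rng a) (h' : Λ.src l' = Λ.rng a')
    (hd : Λ.deg l = Λ.deg l') (hc : Λ.comp l a = Λ.comp l' a') : l = l' ∧ a = a' := by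
  have hda : Λ.deg a = Λ.deg a' := by
    have := congrArg Λ.deg hc
    rw [Λ.deg_comp _ _ h, Λ.deg_comp _ _ h', hd] at this
    exact add_left_cancel this
  have := (Λ.factorisation _ _ _ (Λ.deg_comp l a h)).unique
    (y₁ := (l, a)) (y₂ := (l', a')) ⟨rfl, rfl, h, rfl⟩ ⟨hd.symm, hda.symm, h', hc.symm⟩
  exact Prod.mk.inj this

theorem exists_comp_of_le {l : Λ.Path} {n : Fin k → ℕ} (h : n ≤ Λ.deg l) :
    ∃ a b, Λ.deg a = n ∧ Λ.src a = Λ.rng b ∧ Λ.comp a b = l := by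
  obtain ⟨p, ⟨h1, -, h3, h4⟩, -⟩ :=
    Λ.factorisation l n (Λ.deg l - n) (add_tsub_cancel_of_le h).symm
  exact ⟨p.1, p.2, h1, h3, h4⟩

/-- Every path extending `l` splits off an initial segment extending `l`. -/
theorem exists_comp_factor {l a c d : Λ.Path} (h : Λ.src l = Λ.rng a)
    (hcd : Λ.src c = Λ.rng d) (hc : Λ.comp c d = Λ.comp l a) (hd : Λ.deg l ≤ Λ.deg c) :
    ∃ a', Λ.src l = Λ.rng a' ∧ Λ.comp l a' = c ∧ Λ.src a' = Λ.rng d ∧ Λ.comp a' d = a := by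
  obtain ⟨l', a', hl', h', rfl⟩ := Λ.exists_comp_of_le hd
  rw [Λ.src_comp _ _ h'] at hcd
  rw [Λ.comp_assoc _ _ _ h' hcd] at hc
  obtain ⟨rfl, rfl⟩ := Λ.comp_inj (h'.trans (Λ.rng_comp _ _ hcd).symm) h hl' hc
  exact ⟨a', h', rfl, hcd, rfl⟩

/-- Every common extension factors through a minimal common extension. -/
theorem exists_minExt_of_comp_eq {l m a b : Λ.Path} (ha : Λ.src l = Λ.rng a)
    (hb : Λ.src m = Λ.rng b) (h : Λ.comp l a = Λ.comp m b) :
    ∃ p ∈ Λ.minExt l m, ∃ d, Λ.src p.1 = Λ.rng d ∧ Λ.comp p.1 d = a := by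
  have hle : Λ.deg l ⊔ Λ.deg m ≤ Λ.deg (Λ.comp l a) := by
    refine sup_le ?_ ?_
    · rw [Λ.deg_comp _ _ ha]; exact le_self_add
    · rw [h, Λ.deg_comp _ _ hb]; exact le_self_add
  obtain ⟨c, d, hc, hcd, hcomp⟩ := Λ.exists_comp_of_le hle
  obtain ⟨a', h1, h2, h3, h4⟩ := Λ.exists_comp_factor ha hcd hcomp (hc ▸ le_sup_left)
  obtain ⟨b', h5, h6, -, -⟩ := Λ.exists_comp_factor hb hcd (hcomp.trans h) (hc ▸ le_sup_right)
  exact ⟨(a', b'), ⟨h1, h5, h2.trans h6.symm, h2 ▸ hc⟩, d, h3, h4⟩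

/-- `Ext(μ;E)`, the tails `α` of minimal common extensions of `μ` with members of `E`. -/
def extSet (μ : Λ.Path) (E : Set Λ.Path) : Set Λ.Path :=
  ⋃ l ∈ E, Prod.fst '' Λ.minExt μ l

/-- The initial edges of the members of `E`. -/
def initialEdges (E : Set Λ.Path) : Set Λ.Path :=
  {e | Λ.IsEdge e ∧ ∃ a, Λ.src e = Λ.rng a ∧ Λ.comp e a ∈ E}

variable {Λ}

theorem mem_extSet {μ α : Λ.Path} {E : Set Λ.Path} :
    α ∈ Λ.extSet μ E ↔ ∃ l ∈ E, ∃ β, (α, β) ∈ Λ.minExt μ l := by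
  simp [extSet]

theorem FinitelyAligned.finite_extSet (hΛ : Λ.FinitelyAligned) (μ : Λ.Path)
    {E : Set Λ.Path} (hE : E.Finite) : (Λ.extSet μ E).Finite :=
  hE.biUnion fun l _ => (hΛ μ l).image _

theorem extSet_subset_withRange (μ : Λ.Path) (E : Set Λ.Path) :
    Λ.extSet μ E ⊆ Λ.withRange (Λ.src μ) := by
  intro α hα
  obtain ⟨l, -, β, h, -⟩ := mem_extSet.mp hα
  exact h.symm

theorem Exhaustive.extSet {v μ : Λ.Path} {E : Set Λ.Path} (hE : Λ.Exhaustive v E)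
    (hμ : Λ.rng μ = v) : Λ.Exhaustive (Λ.src μ) (Λ.extSet μ E) := by
  intro σ hσ
  replace hσ : Λ.src μ = Λ.rng σ := Eq.symm hσ
  obtain ⟨l, hl, ⟨a, b⟩, ha, hb, hab, -⟩ :=
    hE (Λ.comp μ σ) ((Λ.rng_comp _ _ hσ).trans hμ)
  dsimp only at ha hb hab
  rw [Λ.src_comp _ _ hσ] at hb
  rw [Λ.comp_assoc _ _ _ hσ hb] at hab
  obtain ⟨p, hp, d, hd, hpd⟩ := Λ.exists_minExt_of_comp_eq
    (hσ.trans (Λ.rng_comp _ _ hb).symm) ha hab.symm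
  obtain ⟨q, hq, -⟩ := Λ.exists_minExt_of_comp_eq hd hb hpd
  exact ⟨p.1, mem_extSet.mpr ⟨l, hl, p.2, hp⟩, q, hq⟩

theorem finite_initialEdges {E : Set Λ.Path} (hE : E.Finite) :
    (Λ.initialEdges E).Finite := by
  have hfin : (E ×ˢ (Set.univ : Set (Fin k))).Finite := hE.prod Set.finite_univ
  refine (hfin.biUnion (t := fun p => {e | Λ.deg e = Pi.single p.2 1 ∧
    ∃ a, Λ.src e = Λ.rng a ∧ Λ.comp e a = p.1}) fun p _ => ?_).subset ?_
  · refine Set.Subsingleton.finite ?_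
    rintro e ⟨he, a, ha, hea⟩ e' ⟨he', a', ha', hea'⟩
    exact (Λ.comp_inj ha ha' (he.trans he'.symm) (hea.trans hea'.symm)).1
  · rintro e ⟨⟨i, hi⟩, a, ha, hE'⟩
    exact Set.mem_biUnion (x := (Λ.comp e a, i)) ⟨hE', trivial⟩ ⟨hi, a, ha, rfl⟩

theorem rng_of_mem_initialEdges {v e : Λ.Path} {E : Set Λ.Path} (hE : E ⊆ Λ.withRange v)
    (he : e ∈ Λ.initialEdges E) : Λ.rng e = v := by
  obtain ⟨-, a, ha, h⟩ := he
  exact (Λ.rng_comp _ _ ha).symm.trans (hE h)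

theorem Exhaustive.initialEdges {v : Λ.Path} {E : Set Λ.Path} (hE : Λ.Exhaustive v E)
    (h0 : ∀ l ∈ E, Λ.deg l ≠ 0) : Λ.Exhaustive v (Λ.initialEdges E) := by
  intro m hm
  obtain ⟨l, hl, ⟨a, b⟩, ha, hb, hab, -⟩ := hE m hm
  dsimp only at ha hb hab
  obtain ⟨i, hi⟩ := Function.ne_iff.mp (h0 l hl)
  have hle : Pi.single i 1 ≤ Λ.deg l := by
    intro j
    rcases eq_or_ne j i with rfl | hj
    · simpa [Nat.one_le_iff_ne_zero] using hi
    · simp [hj]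
  obtain ⟨e, c, he, hec, rfl⟩ := Λ.exists_comp_of_le hle
  rw [Λ.src_comp _ _ hec] at ha
  rw [Λ.comp_assoc _ _ _ hec ha] at hab
  obtain ⟨p, hp, -⟩ := Λ.exists_minExt_of_comp_eq
    (hec.trans (Λ.rng_comp _ _ ha).symm) hb hab
  exact ⟨e, ⟨⟨i, he⟩, c, hec, hl⟩, p, hp⟩

theorem Exhaustive.nonempty {v : Λ.Path} {E : Set Λ.Path} (hE : Λ.Exhaustive v E)
    (hv : Λ.IsVertex v) : E.Nonempty := by
  obtain ⟨l, hl, -⟩ := hE v (Λ.rng_eq_of_deg_zero v hv)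
  exact ⟨l, hl⟩

/-- If the degrees in `E` are bounded by `N` and `μ` is an initial edge of degree `e_i` of a
member of `E`, then the degrees in `Ext(μ;E)` are bounded by `N - e_i`. -/
theorem deg_le_sub_single_of_mem_extSet {E : Set Λ.Path} {N : Fin k → ℕ} {μ α : Λ.Path}
    {i : Fin k} (hN : ∀ l ∈ E, Λ.deg l ≤ N) (hμ : Λ.deg μ = Pi.single i 1)
    (hi : Pi.single i 1 ≤ N) (hα : α ∈ Λ.extSet μ E) : Λ.deg α ≤ N - Pi.single i 1 := by
  obtain ⟨l, hl, β, h1, -, -, h4⟩ := mem_extSet.mp hα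
  dsimp only at h1 h4
  rw [Λ.deg_comp _ _ h1, hμ] at h4
  refine le_tsub_of_add_le_left ?_
  rw [h4]
  exact sup_le hi (hN l hl)

namespace IsCK13

variable {A : Type*} [Ring A] [StarRing A] {t : Λ.Path → A}

theorem rng_mul (ht : Λ.IsCK13 t) (l : Λ.Path) : t (Λ.rng l) * t l = t l := by
  rw [ht.comp_mul _ _ (Λ.src_rng l), Λ.rng_comp_self]

theorem mul_src (ht : Λ.IsCK13 t) (l : Λ.Path) : t l * t (Λ.src l) = t l := by
  rw [ht.comp_mul _ _ (Λ.rng_src l).symm, Λ.comp_src_self]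

theorem commute_range (ht : Λ.IsCK13 t) (l m : Λ.Path) :
    Commute (t l * star (t l)) (t m * star (t m)) := by
  have hsa : star (t l * star (t l) * (t m * star (t m))) =
      t l * star (t l) * (t m * star (t m)) := by
    have key : t l * star (t l) * (t m * star (t m)) =
        t l * (star (t l) * t m) * star (t m) := by simp only [mul_assoc]
    rw [key, ht.ck3, setSum]
    split_ifs with h
    · rw [Finset.mul_sum, Finset.sum_mul, star_sum]
      refine Finset.sum_congr rfl fun p hp => ?_
      obtain ⟨h1, h2, h3, -⟩ := h.mem_toFinset.mp hp
      have : t l * (t p.1 * star (t p.2)) * star (t m) =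
          (t l * t p.1) * star (t m * t p.2) := by
        simp only [star_mul, mul_assoc]
      rw [this, ht.comp_mul _ _ h1, ht.comp_mul _ _ h2, h3]
      simp
    · simp
  have := hsa
  simp only [star_mul, star_star] at this
  exact this.symm

theorem self_mul_star_of_isVertex (ht : Λ.IsCK13 t) {v : Λ.Path} (hv : Λ.IsVertex v) :
    t v * star (t v) = t v := by
  rw [(ht.vertex_projection v hv).1, (ht.vertex_projection v hv).2]

theorem commute_sub_range (ht : Λ.IsCK13 t) {v : Λ.Path} (hv : Λ.IsVertex v) (l m : Λ.Path) :
    Commute (t v - t l * star (t l)) (t v - t m * star (t m)) := by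
  have hcv := ht.commute_range v
  rw [ht.self_mul_star_of_isVertex hv] at hcv
  exact ((Commute.refl _).sub_right (hcv m)).sub_left
    ((hcv l).symm.sub_right (ht.commute_range l m))

/-- The gap projection of `E` vanishes exactly when every element supported on `t v` and
annihilating the `t l` with `l ∈ E` vanishes. -/
theorem setProd_eq_zero_iff (ht : Λ.IsCK13 t) {v : Λ.Path} (hv : Λ.IsVertex v)
    {E : Set Λ.Path} (hE : E.Finite) (hne : E.Nonempty) (hEv : E ⊆ Λ.withRange v) :
    setProd E (fun l => t v - t l * star (t l)) = 0 ↔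
      ∀ x : A, x * t v = x → (∀ l ∈ E, x * t l = 0) → x = 0 := by
  constructor
  · intro h x hx hxE
    rw [← mul_setProd_eq_self (fun l => t v - t l * star (t l)) x, h, mul_zero]
    intro l hl
    rw [mul_sub, hx, ← mul_assoc, hxE l hl, zero_mul, sub_zero]
  · intro h
    have hfac : ∀ l ∈ E, ∃ c, setProd E (fun l => t v - t l * star (t l)) =
        c * (t v - t l * star (t l)) := fun l hl =>
      exists_setProd_eq_mul_of_mem hE _ (ht.commute_sub_range hv) hl
    have hvl : ∀ l ∈ E, t v * t l = t l := by
      intro l hl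
      rw [← hEv hl, ht.rng_mul]
    refine h _ ?_ fun l hl => ?_
    · obtain ⟨l, hl⟩ := hne
      obtain ⟨c, hc⟩ := hfac l hl
      obtain ⟨hs, hp⟩ := ht.vertex_projection v hv
      have hstar : star (t l) * t v = star (t l) := by
        have := congrArg star (hvl l hl)
        rwa [star_mul, hs] at this
      rw [hc, mul_assoc, sub_mul, hp, mul_assoc, hstar]
    · obtain ⟨c, hc⟩ := hfac l hl
      rw [hc, mul_assoc, sub_mul, hvl l hl, ht.partialIsometry, sub_self, mul_zero]

/-- Reduction of a finite exhaustive set to exhaustive sets of edges, by induction on a bound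
for the degrees. -/
theorem eq_zero_of_exhaustive (ht : Λ.IsCK13 t) (hΛ : Λ.FinitelyAligned)
    (hedge : ∀ v, Λ.IsVertex v → ∀ E : Set Λ.Path, E.Finite →
      E ⊆ {e | Λ.rng e = v ∧ Λ.IsEdge e} → Λ.Exhaustive v E →
      ∀ x : A, x * t v = x → (∀ l ∈ E, x * t l = 0) → x = 0)
    (N : Fin k → ℕ) (v : Λ.Path) (hv : Λ.IsVertex v) (E : Set Λ.Path) (hfin : E.Finite)
    (hEv : E ⊆ Λ.withRange v) (hE : Λ.Exhaustive v E) (hN : ∀ l ∈ E, Λ.deg l ≤ N)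
    (x : A) (hx : x * t v = x) (hxE : ∀ l ∈ E, x * t l = 0) : x = 0 := by
  induction N using WellFoundedLT.induction generalizing v E x with
  | ind N ih =>
  by_cases h0 : ∀ l ∈ E, Λ.deg l ≠ 0
  · refine hedge v hv _ (finite_initialEdges hfin)
      (fun e he => ⟨rng_of_mem_initialEdges hEv he, he.1⟩) (hE.initialEdges h0) x hx ?_
    intro μ hμ
    have hrng := rng_of_mem_initialEdges hEv hμ
    obtain ⟨⟨i, hi⟩, a, ha, haE⟩ := hμ
    have hiN : Pi.single i 1 ≤ N := by
      refine le_trans ?_ (hN _ haE)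
      rw [Λ.deg_comp _ _ ha, hi]
      exact le_self_add
    have hlt : N - Pi.single i 1 < N := by
      refine lt_of_le_of_ne tsub_le_self fun h => ?_
      have h1 := congrFun h i
      have h2 := hiN i
      simp only [Pi.sub_apply, Pi.single_eq_same] at h1 h2
      omega
    refine ih _ hlt (Λ.src μ) (Λ.deg_src μ) (Λ.extSet μ E) (hΛ.finite_extSet μ hfin)
      (extSet_subset_withRange μ E) (hE.extSet hrng)
      (fun α hα => deg_le_sub_single_of_mem_extSet hN hi hiN hα) _ ?_ ?_
    · rw [mul_assoc, ht.mul_src]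
    · intro α hα
      obtain ⟨l, hl, β, h1, h2, h3, -⟩ := mem_extSet.mp hα
      dsimp only at h1 h2 h3
      rw [mul_assoc, ht.comp_mul _ _ h1, h3, ← ht.comp_mul _ _ h2, ← mul_assoc, hxE l hl,
        zero_mul]
  · push Not at h0
    obtain ⟨l, hl, hl0⟩ := h0
    have hlv : l = v := (Λ.eq_rng_of_deg_eq_zero hl0).trans (hEv hl)
    rw [← hx, ← hlv, hxE l hl]

end IsCK13

end KGraph

/-- a family satisfying (CK1)–(CK3) is a Cuntz–Krieger `Λ`-family iff
(CK4) holds for every finite exhaustive set of edges. -/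
theorem stmt18 {k : ℕ} (Λ : KGraph k) (hΛ : Λ.FinitelyAligned)
    {A : Type*} [CStarAlgebra A] (t : Λ.Path → A) (ht : Λ.IsCK13 t) :
    Λ.IsCKFamily t ↔
      ∀ v, Λ.IsVertex v → ∀ E : Set Λ.Path, E.Finite →
        E ⊆ {e | Λ.rng e = v ∧ Λ.IsEdge e} → Λ.Exhaustive v E →
        setProd E (fun l => t v - t l * star (t l)) = 0 := by
  constructor
  · intro h v hv E hfin hE hex
    exact h.ck4 v E hv (fun e he => (hE he).1) hfin hex
  · intro h
    refine ⟨ht, fun v E hv hEv hfin hex => ?_⟩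
    refine (ht.setProd_eq_zero_iff hv hfin (hex.nonempty hv) hEv).mpr ?_
    obtain ⟨N, hN⟩ := (hfin.image Λ.deg).bddAbove
    refine ht.eq_zero_of_exhaustive hΛ ?_ N v hv E hfin hEv hex
      fun l hl => hN (Set.mem_image_of_mem _ hl)
    intro w hw F hF hFe hFex
    exact (ht.setProd_eq_zero_iff hw hF (hFex.nonempty hw) fun e he => (hFe he).1).mp
      (h w hw F hF hFe hFex)
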